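/- Let p > 3 be a prime with p ≡ 3 (mod 4), and let K = ℚ(√−p) with class number h_K. Then h_K² = 2 · Σ_{b=1, (b/p)=1}^{p−1} s(b,p), where the sum ranges over the quadratic residues b modulo p with 1 ≤ b ≤ p−1. -/

import Mathlib

open Finset Real NumberField

/-- The Dedekind sum `s(c,d) = (1/(4d)) ∑_{n=1}^{d-1} cot(πn/d) cot(πnc/d)`. -/
noncomputable def dedekindSum (c : ℤ) (d : ℕ) : ℝ :=
  (1 / (4 * (d : ℝ))) *
    ∑ n ∈ Finset.Ioo 0 d, Real.cot (Real.pi * n / d) * Real.cot (Real.pi * n * c / d)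

section partA


/-- `θ` is the standard generator `(1+√-p)/2` of the ring of integers -/
structure QGen (p : ℕ) (K : Type*) [Field K] (θ : 𝓞 K) (c : ℤ) : Prop where
  hc : 4 * c = p + 1
  sq : θ ^ 2 = θ - (c : 𝓞 K)
  rep : ∀ x : 𝓞 K, ∃ a b : ℤ, x = a + b * θ
  uniq : ∀ a b : ℤ, (a : 𝓞 K) + b * θ = 0 → a = 0 ∧ b = 0

lemma exists_rat_rep (p : ℕ) [Fact p.Prime] (K : Type*) [Field K] [NumberField K]
    (α : K) (hα : α ^ 2 = -(p : K)) (hquad : Module.finrank ℚ K = 2) :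
    (∀ x : K, ∃ u v : ℚ, x = u + v * α) ∧ (∀ u v : ℚ, (u : K) + v * α = 0 → u = 0 ∧ v = 0) := by
  have hp : 0 < (p : ℚ) := by exact_mod_cast (Fact.out : p.Prime).pos
  have huniq : ∀ u v : ℚ, (u : K) + v * α = 0 → u = 0 ∧ v = 0 := by
    intro u v h
    have h1 : ((u ^ 2 + p * v ^ 2 : ℚ) : K) = 0 := by
      push_cast
      have : (u : K) = - (v * α) := by linear_combination h
      rw [this]; linear_combination (v : K) ^ 2 * hα
    have h2 : u ^ 2 + p * v ^ 2 = 0 := by exact_mod_cast h1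
    have h3 : u ^ 2 = 0 := by nlinarith [sq_nonneg u, mul_nonneg hp.le (sq_nonneg v)]
    have h4 : p * v ^ 2 = 0 := by nlinarith [sq_nonneg u, mul_nonneg hp.le (sq_nonneg v)]
    refine ⟨by simpa using h3, ?_⟩
    have := (mul_eq_zero.mp h4).resolve_left hp.ne'
    simpa using this
  refine ⟨?_, huniq⟩
  have hli : LinearIndependent ℚ ![(1 : K), α] := by
    rw [LinearIndependent.pair_iff]
    intro s t h
    apply huniq
    simpa [Algebra.smul_def] using h
  let b := basisOfLinearIndependentOfCardEqFinrank hli (by simp [hquad])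
  intro x
  refine ⟨b.repr x 0, b.repr x 1, ?_⟩
  have := b.sum_repr x
  simp [b, Algebra.smul_def, Fin.sum_univ_two] at this
  exact this.symm

lemma int_of_isIntegral (u : ℚ) (h : IsIntegral ℤ (u : ℂ)) : ∃ m : ℤ, u = m := by
  have : IsIntegral ℤ u := by
    have h' : IsIntegral ℤ (algebraMap ℚ ℂ u) := by simpa using h
    exact (isIntegral_algebraMap_iff (algebraMap ℚ ℂ).injective).mp h'
  obtain ⟨m, hm⟩ := IsIntegrallyClosed.isIntegral_iff.mp this
  exact ⟨m, by simpa using hm.symm⟩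

lemma half_int (p : ℕ) [hpp : Fact p.Prime] (n : ℤ) (w : ℚ) (h : p * w ^ 2 = n) : ∃ m : ℤ, w = m := by
  have hp := hpp.out
  have hp0 : (p:ℚ) ≠ 0 := by exact_mod_cast hp.ne_zero
  -- p*w is a rational whose square is an integer
  have h1 : IsIntegral ℤ ((p : ℚ) * w) := by
    refine IsIntegral.of_pow (n := 2) (by norm_num) ?_
    have : ((p : ℚ) * w) ^ 2 = ((p * n : ℤ) : ℚ) := by push_cast; rw [← h]; ring
    rw [this]; exact isIntegral_algebraMap (A := ℚ) (x := (p * n : ℤ))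
  obtain ⟨k, hk⟩ := IsIntegrallyClosed.isIntegral_iff.mp h1
  simp at hk
  have h2 : k ^ 2 = p * n := by
    have : ((k ^ 2 : ℤ) : ℚ) = ((p * n : ℤ) : ℚ) := by push_cast; rw [hk, ← h]; ring
    exact_mod_cast this
  have h3 : (p : ℤ) ∣ k := (Nat.prime_iff_prime_int.mp hp).dvd_of_dvd_pow (Dvd.intro _ h2.symm)
  obtain ⟨m, rfl⟩ := h3
  refine ⟨m, ?_⟩
  push_cast at hk
  exact (mul_left_cancel₀ hp0 hk).symm

lemma exists_QGen (p : ℕ) [Fact p.Prime] (hp4 : p % 4 = 3)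
    (K : Type*) [Field K] [NumberField K]
    (α : K) (hα : α ^ 2 = -(p : K)) (hquad : Module.finrank ℚ K = 2) :
    ∃ (θ : 𝓞 K) (c : ℤ), QGen p K θ c := by
  obtain ⟨hrep, huniq⟩ := exists_rat_rep p K α hα hquad
  obtain ⟨c, hc⟩ : ∃ c : ℤ, 4 * c = p + 1 := ⟨(p + 1) / 4, by omega⟩
  have hcK : (4 : K) * c = p + 1 := by exact_mod_cast congrArg (Int.cast : ℤ → K) hc
  let t : K := (1 + α) / 2
  have ht : t ^ 2 = t - c := by
    simp only [t]; field_simp; linear_combination hα + hcK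
  have hInt : IsIntegral ℤ t := by
    refine ⟨Polynomial.X ^ 2 - Polynomial.X + Polynomial.C c, ?_, ?_⟩
    · monicity!
    · rw [Polynomial.eval₂_add, Polynomial.eval₂_sub, Polynomial.eval₂_pow, Polynomial.eval₂_X,
        Polynomial.eval₂_C, ht]; simp
  have hα' : α = 2 * t - 1 := by simp only [t]; ring
  let θ : 𝓞 K := ⟨t, hInt⟩
  have hθ : (θ : K) = t := rfl
  refine ⟨θ, c, hc, ?_, ?_, ?_⟩
  · apply RingOfIntegers.ext
    simp [hθ, ht]
  · intro x
    obtain ⟨u, v, hx⟩ := hrep x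
    obtain ⟨φ⟩ : Nonempty (K →+* ℂ) := inferInstance
    have hxi : IsIntegral ℤ (φ x) := map_isIntegral_int φ x.isIntegral_coe
    have hxi' : IsIntegral ℤ (starRingEnd ℂ (φ x)) := map_isIntegral_int (starRingEnd ℂ) hxi
    have hpos : (0:ℝ) < p := by exact_mod_cast (Fact.out : p.Prime).pos
    have hφ2 : (φ α) ^ 2 = -(p : ℂ) := by rw [← map_pow, hα]; simp
    have hre : (φ α).re = 0 ∧ (φ α).im ^ 2 = p := by
      have e1 := congrArg Complex.re hφ2
      have e2 := congrArg Complex.im hφ2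
      simp [pow_two] at e1 e2
      have e3 : (φ α).re * (φ α).im = 0 := by linarith
      rcases mul_eq_zero.mp e3 with h | h
      · refine ⟨h, ?_⟩; rw [h] at e1; linarith
      · exfalso; rw [h] at e1; nlinarith [sq_nonneg (φ α).re]
    have hconj : starRingEnd ℂ (φ α) = - φ α := by
      apply Complex.ext <;> simp [hre.1]
    have hφx : φ x = u + v * φ α := by rw [hx]; simp
    have hcx : starRingEnd ℂ (φ x) = u - v * φ α := by
      rw [hφx]; simp [hconj]; ring
    obtain ⟨m, hm⟩ := int_of_isIntegral (2 * u) (by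
      have := hxi.add hxi'
      rw [hcx, hφx] at this
      have e : ((2 * u : ℚ) : ℂ) = u + v * φ α + (u - v * φ α) := by push_cast; ring
      rw [e]; exact this)
    obtain ⟨n, hn⟩ := int_of_isIntegral (u ^ 2 + p * v ^ 2) (by
      have := hxi.mul hxi'
      rw [hcx, hφx] at this
      have e : ((u ^ 2 + p * v ^ 2 : ℚ) : ℂ) = (u + v * φ α) * (u - v * φ α) := by
        push_cast; linear_combination (v : ℂ) ^ 2 * hφ2
      rw [e]; exact this)
    obtain ⟨k, hk⟩ := half_int p (4 * n - m ^ 2) (2 * v) (by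
      push_cast; rw [← hn, ← hm]; ring)
    have hmk : m ^ 2 + p * k ^ 2 = 4 * n := by
      have : ((m ^ 2 + p * k ^ 2 : ℤ) : ℚ) = ((4 * n : ℤ) : ℚ) := by
        push_cast; rw [← hn, ← hm, ← hk]; ring
      exact_mod_cast this
    have hpar : (m - k) % 2 = 0 := by
      have hpo : (p : ℤ) = 4 * c - 1 := by linarith
      rw [hpo] at hmk
      have : (m - k) * (m + k) = 4 * (n - c * k ^ 2) := by linear_combination hmk
      by_contra hne
      have h1 : (m - k) % 2 = 1 := by omega
      have h2 : (m + k) % 2 = 1 := by omega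
      have h3 : ((m - k) * (m + k)) % 2 = 1 := by rw [Int.mul_emod, h1, h2]; rfl
      omega
    obtain ⟨a, ha⟩ := Int.dvd_of_emod_eq_zero hpar
    refine ⟨a, k, ?_⟩
    apply RingOfIntegers.ext
    simp only [map_add, map_mul, map_intCast, hθ]
    rw [hx]
    have h1 : u = (2 * a + k) / 2 := by
      have : (m : ℚ) = 2 * a + k := by exact_mod_cast (by linarith : m = 2 * a + k)
      rw [← this, ← hm]; ring
    have h2 : v = k / 2 := by rw [← hk]; ring
    rw [h1, h2, hα']
    push_cast; ring
  · intro a b h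
    have h' : (a : K) + b * t = 0 := by
      have := congrArg (algebraMap (𝓞 K) K) h
      simpa [hθ] using this
    have := huniq (a + b / 2) (b / 2) (by
      push_cast; rw [hα']; linear_combination h')
    have hb : (b : ℚ) = 0 := by linarith [this.2]
    have ha : (a : ℚ) = 0 := by linarith [this.1]
    exact ⟨by exact_mod_cast ha, by exact_mod_cast hb⟩

end partA

section partB


section
variable {p : ℕ} {K : Type*} [Field K] [NumberField K] {θ : 𝓞 K} {c : ℤ}

lemma QGen.ext (h : QGen p K θ c) {a b a' b' : ℤ}
    (e : (a : 𝓞 K) + b * θ = a' + b' * θ) : a = a' ∧ b = b' := by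
  have := h.uniq (a - a') (b - b') (by push_cast; linear_combination e)
  omega

/-- multiplicativity of the norm form -/
lemma QGen.mul (h : QGen p K θ c) {a b a' b' A B : ℤ}
    (e : ((a : 𝓞 K) + b * θ) * (a' + b' * θ) = A + B * θ) :
    (a ^ 2 + a * b + c * b ^ 2) * (a' ^ 2 + a' * b' + c * b' ^ 2) = A ^ 2 + A * B + c * B ^ 2 := by
  have h1 : ((a * a' - c * b * b' : ℤ) : 𝓞 K) + ((a * b' + a' * b + b * b' : ℤ) : 𝓞 K) * θ
      = A + B * θ := by
    rw [← e]; push_cast; linear_combination - (b : 𝓞 K) * b' * h.sq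
  obtain ⟨rfl, rfl⟩ := h.ext h1
  ring

lemma QGen.unit (h : QGen p K θ c) (hp3 : 4 < p) (u : (𝓞 K)ˣ) : u = 1 ∨ u = -1 := by
  obtain ⟨a, b, hx⟩ := h.rep u
  obtain ⟨a', b', hx'⟩ := h.rep (u⁻¹ : (𝓞 K)ˣ)
  have e : ((a : 𝓞 K) + b * θ) * (a' + b' * θ) = (1 : ℤ) + (0 : ℤ) * θ := by
    rw [← hx, ← hx']; simp
  have := h.mul e
  have hc := h.hc
  have hpos : ∀ a b : ℤ, 0 ≤ a ^ 2 + a * b + c * b ^ 2 := by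
    intro a b
    have : 4 * (a ^ 2 + a * b + c * b ^ 2) = (2 * a + b) ^ 2 + p * b ^ 2 := by
      linear_combination b ^ 2 * hc
    have : 0 ≤ (p : ℤ) * b ^ 2 := by positivity
    nlinarith [sq_nonneg (2 * a + b)]
  have h1 : a ^ 2 + a * b + c * b ^ 2 = 1 := by
    have h2 : (a ^ 2 + a * b + c * b ^ 2) * (a' ^ 2 + a' * b' + c * b' ^ 2) = 1 := by
      rw [this]; ring
    exact Int.eq_one_of_mul_eq_one_right (hpos a b) h2
  have h4 : (2 * a + b) ^ 2 + p * b ^ 2 = 4 := by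
    linear_combination - b ^ 2 * hc + 4 * h1
  have hp' : (4 : ℤ) < p := by exact_mod_cast hp3
  have hb : b = 0 := by
    by_contra hb
    have : 1 ≤ b ^ 2 := by have := sq_pos_of_ne_zero (a := b) hb; omega
    nlinarith [sq_nonneg (2 * a + b)]
  subst hb
  have : (a - 1) * (a + 1) = 0 := by linarith [h1]
  rcases mul_eq_zero.mp this with h0 | h0
  · left; apply Units.ext; rw [hx]
    have : a = 1 := by omega
    simp [this]
  · right; apply Units.ext; rw [hx]
    have : a = -1 := by omega
    simp [this]

lemma QGen.torsionOrder (h : QGen p K θ c) (hp3 : 4 < p) : Units.torsionOrder K = 2 := by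
  classical
  let := Fintype.ofFinite (Units.torsion K)
  rw [Units.torsionOrder, Nat.card_eq_fintype_card]
  refine (Finset.card_eq_two.2 ⟨1, ⟨-1, neg_one_mem_torsion⟩,
    by simp [← Subtype.coe_ne_coe], Finset.ext fun x ↦ ⟨fun _ ↦ ?_, fun _ ↦ Finset.mem_univ _⟩⟩)
  rw [Finset.mem_insert, Finset.mem_singleton, ← Subtype.val_inj, ← Subtype.val_inj]
  exact h.unit hp3 x

set_option linter.unusedSectionVars false

noncomputable def QGen.basis (h : QGen p K θ c) : Module.Basis (Fin 2) ℤ (𝓞 K) :=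
  Module.Basis.mk (v := ![1, θ]) (by
    rw [LinearIndependent.pair_iff]
    intro s t e
    apply h.uniq
    simpa using e) (by
    intro x _
    obtain ⟨a, b, rfl⟩ := h.rep x
    rw [Matrix.range_cons, Matrix.range_cons, Matrix.range_empty, Set.union_empty,
      Set.singleton_union, Submodule.mem_span_pair]
    exact ⟨a, b, by simp⟩)

lemma QGen.basis0 (h : QGen p K θ c) : h.basis 0 = 1 := by simp [QGen.basis]
lemma QGen.basis1 (h : QGen p K θ c) : h.basis 1 = θ := by simp [QGen.basis]

lemma QGen.repr (h : QGen p K θ c) (a b : ℤ) : h.basis.repr (a + b * θ) = 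
    Finsupp.equivFunOnFinite.symm ![a, b] := by
  apply h.basis.repr.symm.injective
  rw [LinearEquiv.symm_apply_apply, Module.Basis.repr_symm_apply, Finsupp.linearCombination_apply,
    Finsupp.sum_fintype _ _ (by simp)]
  simp [Fin.sum_univ_two, h.basis0, h.basis1]

lemma QGen.trace (h : QGen p K θ c) (a b : ℤ) : Algebra.trace ℤ (𝓞 K) (a + b * θ) = 2 * a + b := by
  have h1 : Algebra.trace ℤ (𝓞 K) θ = 1 := by
    rw [Algebra.trace_eq_matrix_trace h.basis, Matrix.trace_fin_two, Algebra.leftMulMatrix_eq_repr_mul,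
      Algebra.leftMulMatrix_eq_repr_mul, h.basis0, h.basis1]
    have e1 : θ * 1 = ((0 : ℤ) : 𝓞 K) + (1 : ℤ) * θ := by simp
    have e2 : θ * θ = ((- c : ℤ) : 𝓞 K) + (1 : ℤ) * θ := by
      push_cast; linear_combination h.sq
    rw [e1, e2, h.repr, h.repr]
    simp
  have h2 : Algebra.trace ℤ (𝓞 K) 1 = 2 := by
    rw [Algebra.trace_eq_matrix_trace h.basis, Matrix.trace_fin_two, Algebra.leftMulMatrix_eq_repr_mul,
      Algebra.leftMulMatrix_eq_repr_mul, h.basis0, h.basis1]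
    have e1 : (1 : 𝓞 K) * 1 = ((1 : ℤ) : 𝓞 K) + (0 : ℤ) * θ := by simp
    have e2 : 1 * θ = ((0 : ℤ) : 𝓞 K) + (1 : ℤ) * θ := by simp
    rw [e1, e2, h.repr, h.repr]
    simp
  have e : (a : 𝓞 K) + b * θ = a • (1 : 𝓞 K) + b • θ := by simp
  rw [e, map_add, map_smul, map_smul, h1, h2]
  simp; ring

lemma QGen.discr (h : QGen p K θ c) : NumberField.discr K = - p := by
  rw [← discr_eq_discr K h.basis, Algebra.discr_def, Matrix.det_fin_two]
  simp only [Algebra.traceMatrix_apply, Algebra.traceForm_apply, h.basis0, h.basis1]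
  have e0 : (1 : 𝓞 K) * 1 = ((1 : ℤ) : 𝓞 K) + (0 : ℤ) * θ := by simp
  have e1 : θ * 1 = ((0 : ℤ) : 𝓞 K) + (1 : ℤ) * θ := by simp
  have e3 : 1 * θ = ((0 : ℤ) : 𝓞 K) + (1 : ℤ) * θ := by simp
  have e2 : θ * θ = ((- c : ℤ) : 𝓞 K) + (1 : ℤ) * θ := by
      push_cast; linear_combination h.sq
  rw [e0, e1, e2, e3, h.trace, h.trace, h.trace]
  linarith [h.hc]

end

lemma abs_det_empty (ι : Type*) (_ : DecidableEq ι) (_ : Fintype ι) (_ : IsEmpty ι)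
    (M : Matrix ι ι ℝ) : |M.det| = 1 := by
  rw [Matrix.det_isEmpty]; simp

lemma residue_eq (p : ℕ) [Fact p.Prime] (hp3 : 3 < p) (hp4 : p % 4 = 3)
    (K : Type*) [Field K] [NumberField K]
    (α : K) (hα : α ^ 2 = -(p : K)) (hquad : Module.finrank ℚ K = 2) :
    dedekindZeta_residue K = π * classNumber K / √p := by
  obtain ⟨θ, c, h⟩ := exists_QGen p hp4 K α hα hquad
  have hp0 : (0:ℝ) < p := by positivity
  have hreal : InfinitePlace.nrRealPlaces K = 0 := by
    rw [nrRealPlaces_eq_zero_iff, isTotallyComplex_iff]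
    intro w
    rw [← InfinitePlace.not_isReal_iff_isComplex, InfinitePlace.isReal_iff]
    intro hr
    rw [ComplexEmbedding.isReal_iff] at hr
    have h1 := congrArg (fun f => f α) hr
    simp only [ComplexEmbedding.conjugate_coe_eq] at h1
    have him : (w.embedding α).im = 0 := Complex.conj_eq_iff_im.mp h1
    have h2 : (w.embedding α) ^ 2 = -(p : ℂ) := by rw [← map_pow, hα]; simp
    have e1 := congrArg Complex.re h2
    simp [pow_two, him] at e1
    nlinarith [sq_nonneg (w.embedding α).re]
  have hcomplex : InfinitePlace.nrComplexPlaces K = 1 := by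
    have := InfinitePlace.card_add_two_mul_card_eq_rank K
    omega
  have hrank : Units.rank K = 0 := by
    rw [Units.rank, InfinitePlace.card_eq_nrRealPlaces_add_nrComplexPlaces]; omega
  have hreg : Units.regulator K = 1 := by
    obtain ⟨w'⟩ : Nonempty (InfinitePlace K) := inferInstance
    have hcard : Fintype.card (InfinitePlace K) = 1 := by
      rw [InfinitePlace.card_eq_nrRealPlaces_add_nrComplexPlaces]; omega
    have hss := (Fintype.card_le_one_iff_subsingleton.mp hcard.le)
    have hE : IsEmpty {w // w ≠ w'} := ⟨fun w => w.2 (Subsingleton.elim _ _)⟩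
    have hE' : IsEmpty (Fin (Units.rank K)) := by rw [hrank]; infer_instance
    rw [Units.regulator_eq_det K w' (Equiv.equivOfIsEmpty _ _)]
    exact abs_det_empty _ _ _ hE _
  rw [dedekindZeta_residue_def, hreal, hcomplex, hreg, h.torsionOrder (by omega), h.discr]
  simp
  field_simp

end partB

section partC
open Ideal


section
variable {K : Type*} [Field K] [NumberField K]

lemma natCast_mem_of_absNorm {I : Ideal (𝓞 K)} {m : ℕ} (h : absNorm I = m) : (m : 𝓞 K) ∈ I := by
  rw [← h]; exact Ideal.absNorm_mem I

lemma absNorm_span_nat (hquad : Module.finrank ℚ K = 2) (m : ℕ) :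
    absNorm (span {(m : 𝓞 K)}) = m ^ 2 := by
  have h2 : Module.finrank ℤ (𝓞 K) = 2 := by rw [RingOfIntegers.rank, hquad]
  rw [Ideal.absNorm_span_singleton]
  have : (m : 𝓞 K) = algebraMap ℤ (𝓞 K) m := by simp
  rw [this, Algebra.norm_algebraMap_of_basis (RingOfIntegers.basis K), 
    ← Module.finrank_eq_card_basis (RingOfIntegers.basis K), h2]
  simp [Int.natAbs_pow]

lemma card_ideal_mul (hquad : Module.finrank ℚ K = 2) {m n : ℕ} (hm : m ≠ 0) (hn : n ≠ 0)
    (hmn : m.Coprime n) :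
    Nat.card {I : Ideal (𝓞 K) // absNorm I = m * n} =
      Nat.card {I : Ideal (𝓞 K) // absNorm I = m} * Nat.card {I : Ideal (𝓞 K) // absNorm I = n} := by
  rw [← Nat.card_prod]
  -- Bezout
  have htop : ∀ I : Ideal (𝓞 K), (m : 𝓞 K) ∈ I → (n : 𝓞 K) ∈ I → I = ⊤ := by
    intro I h1 h2
    rw [Ideal.eq_top_iff_one]
    have hb := Nat.isCoprime_iff_coprime.mpr hmn
    obtain ⟨u, v, huv⟩ := hb
    have : (1 : 𝓞 K) = u * m + v * n := by exact_mod_cast congrArg (Int.cast : ℤ → 𝓞 K) huv.symm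
    rw [this]
    exact I.add_mem (I.mul_mem_left _ h1) (I.mul_mem_left _ h2)
  have hfac : ∀ I : Ideal (𝓞 K), absNorm I = m * n →
      (I ⊔ span {(m : 𝓞 K)}) * (I ⊔ span {(n : 𝓞 K)}) = I := by
    intro I hI
    have hmem := natCast_mem_of_absNorm hI
    apply le_antisymm
    · rw [Ideal.sup_mul, Ideal.mul_sup, Ideal.mul_sup]
      refine sup_le (sup_le Ideal.mul_le_left Ideal.mul_le_left) (sup_le Ideal.mul_le_right ?_)
      rw [Ideal.span_singleton_mul_span_singleton, Ideal.span_singleton_le_iff_mem]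
      exact_mod_cast hmem
    · have h1 : I * (span {(m : 𝓞 K)} ⊔ span {(n : 𝓞 K)}) = I := by
        rw [htop _ (Ideal.mem_sup_left (Ideal.mem_span_singleton_self _))
          (Ideal.mem_sup_right (Ideal.mem_span_singleton_self _)), Ideal.mul_top]
      conv_lhs => rw [← h1]
      rw [Ideal.mul_sup]
      refine sup_le ?_ ?_
      · rw [mul_comm]; exact Ideal.mul_mono le_sup_right le_sup_left
      · exact Ideal.mul_mono le_sup_left le_sup_right
  have hnorm1 : ∀ (I : Ideal (𝓞 K)) (a b : ℕ), a.Coprime b → 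
      (absNorm (I ⊔ span {(a : 𝓞 K)})).Coprime b := by
    intro I a b hab
    have : absNorm (I ⊔ span {(a : 𝓞 K)}) ∣ a ^ 2 := by
      rw [← absNorm_span_nat hquad]
      exact Ideal.absNorm_dvd_absNorm_of_le le_sup_right
    exact Nat.Coprime.coprime_dvd_left this (hab.pow_left 2)
  have hnorm2 : ∀ I : Ideal (𝓞 K), absNorm I = m * n →
      absNorm (I ⊔ span {(m : 𝓞 K)}) = m ∧ absNorm (I ⊔ span {(n : 𝓞 K)}) = n := by
    intro I hI
    have h1 := congrArg absNorm (hfac I hI)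
    rw [map_mul, hI] at h1
    have c1 := hnorm1 I m n hmn
    have c2 := hnorm1 I n m hmn.symm
    have d1 : absNorm (I ⊔ span {(m : 𝓞 K)}) ∣ m := c1.dvd_of_dvd_mul_right (Dvd.intro _ h1)
    have d2 : m ∣ absNorm (I ⊔ span {(m : 𝓞 K)}) :=
      c2.symm.dvd_of_dvd_mul_right (by rw [h1]; exact Dvd.intro _ rfl)
    have e1 := Nat.dvd_antisymm d1 d2
    refine ⟨e1, ?_⟩
    rw [e1] at h1
    exact Nat.eq_of_mul_eq_mul_left (Nat.pos_of_ne_zero hm) h1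
  have hback : ∀ (A B : Ideal (𝓞 K)) (a b : ℕ), (a : 𝓞 K) ∈ A → (b : 𝓞 K) ∈ B → 
      span {(a : 𝓞 K)} ⊔ B = ⊤ → A * B ⊔ span {(a : 𝓞 K)} = A := by
    intro A B a b ha hb h
    apply le_antisymm
    · exact sup_le Ideal.mul_le_left ((Ideal.span_singleton_le_iff_mem _).mpr ha)
    · calc A = A * (span {(a : 𝓞 K)} ⊔ B) := by rw [h, Ideal.mul_top]
        _ ≤ _ := by
          rw [Ideal.mul_sup]
          exact sup_le (le_trans Ideal.mul_le_right le_sup_right) le_sup_left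
  refine Nat.card_congr 
    { toFun := fun I => (⟨I.1 ⊔ span {(m : 𝓞 K)}, (hnorm2 I.1 I.2).1⟩,
        ⟨I.1 ⊔ span {(n : 𝓞 K)}, (hnorm2 I.1 I.2).2⟩)
      invFun := fun P => ⟨P.1.1 * P.2.1, by rw [map_mul, P.1.2, P.2.2]⟩
      left_inv := fun I => Subtype.ext (hfac I.1 I.2)
      right_inv := ?_ }
  rintro ⟨⟨A, hA⟩, ⟨B, hB⟩⟩
  have hA' := natCast_mem_of_absNorm hA
  have hB' := natCast_mem_of_absNorm hB
  refine Prod.ext (Subtype.ext ?_) (Subtype.ext ?_)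
  · exact hback A B m n hA' hB' (htop _ (Ideal.mem_sup_left (Ideal.mem_span_singleton_self _))
      (Ideal.mem_sup_right hB'))
  · show A * B ⊔ _ = B
    rw [mul_comm]
    exact hback B A n m hB' hA' (htop _ (Ideal.mem_sup_right hA')
      (Ideal.mem_sup_left (Ideal.mem_span_singleton_self _)))

lemma dvd_of_norm_pow {q k : ℕ} {I : Ideal (𝓞 K)} (h : absNorm I = q ^ k) :
    I ∣ span {(q : 𝓞 K)} ^ k := by
  rw [Ideal.dvd_iff_le, Ideal.span_singleton_pow, Ideal.span_singleton_le_iff_mem]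
  exact_mod_cast natCast_mem_of_absNorm h

lemma card_inert {q : ℕ} (hq : q.Prime) (hquad : Module.finrank ℚ K = 2)
    (hP : Prime (span {(q : 𝓞 K)})) (k : ℕ) :
    Nat.card {I : Ideal (𝓞 K) // absNorm I = q ^ k} = if Even k then 1 else 0 := by
  have key : ∀ I : Ideal (𝓞 K), absNorm I = q ^ k → ∃ i, k = 2 * i ∧ I = span {(q : 𝓞 K)} ^ i := by
    intro I hI
    obtain ⟨i, hi, hass⟩ := (dvd_prime_pow hP k).mp (dvd_of_norm_pow hI)
    have := associated_iff_eq.mp hass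
    refine ⟨i, ?_, this⟩
    rw [this, map_pow, absNorm_span_nat hquad, ← pow_mul] at hI
    exact (Nat.pow_right_injective hq.two_le hI).symm
  split_ifs with hk
  · obtain ⟨i, hi⟩ := hk
    rw [Nat.card_eq_one_iff_exists]
    refine ⟨⟨span {(q : 𝓞 K)} ^ i, ?_⟩, ?_⟩
    · rw [map_pow, absNorm_span_nat hquad, ← pow_mul]; congr 1; omega
    · rintro ⟨I, hI⟩
      obtain ⟨j, hj, rfl⟩ := key I hI
      have : i = j := by omega
      subst this; rfl
  · have : IsEmpty {I : Ideal (𝓞 K) // absNorm I = q ^ k} := by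
      refine ⟨fun ⟨I, hI⟩ => hk ?_⟩
      obtain ⟨j, hj, rfl⟩ := key I hI
      exact ⟨j, by omega⟩
    exact Nat.card_of_isEmpty

lemma card_ram {q : ℕ} (hq : q.Prime) {P : Ideal (𝓞 K)} (hP : Prime P) (hN : absNorm P = q)
    (hPP : P * P = span {(q : 𝓞 K)}) (k : ℕ) :
    Nat.card {I : Ideal (𝓞 K) // absNorm I = q ^ k} = 1 := by
  rw [Nat.card_eq_one_iff_exists]
  refine ⟨⟨P ^ k, by rw [map_pow, hN]⟩, ?_⟩
  rintro ⟨I, hI⟩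
  have h1 := dvd_of_norm_pow hI
  rw [← hPP, ← pow_two, ← pow_mul] at h1
  obtain ⟨i, hi, hass⟩ := (dvd_prime_pow hP _).mp h1
  have h2 := associated_iff_eq.mp hass
  subst h2
  rw [map_pow, hN] at hI
  have := Nat.pow_right_injective hq.two_le hI
  subst this; rfl

lemma card_split {q : ℕ} (hq : q.Prime) {P P' : Ideal (𝓞 K)} (hP : Prime P) (hP' : Prime P')
    (hne : P ≠ P') (hN : absNorm P = q) (hN' : absNorm P' = q)
    (hPP : P * P' = span {(q : 𝓞 K)}) (k : ℕ) :
    Nat.card {I : Ideal (𝓞 K) // absNorm I = q ^ k} = k + 1 := by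
  have hnd : ¬ P ∣ P' := fun h => hne (associated_iff_eq.mp (hP.associated_of_dvd hP' h))
  have : Function.Bijective (fun i : Fin (k + 1) =>
      (⟨P ^ (i : ℕ) * P' ^ (k - i), by
        rw [map_mul, map_pow, map_pow, hN, hN', ← pow_add]; congr 1; omega⟩ :
        {I : Ideal (𝓞 K) // absNorm I = q ^ k})) := by
    constructor
    · intro i j hij
      simp only [Subtype.mk.injEq] at hij
      have main : ∀ i j : ℕ, i < j → P ^ i * P' ^ (k - i) ≠ P ^ j * P' ^ (k - j) := by
        intro i j hlt h
        obtain ⟨d, rfl⟩ := Nat.exists_eq_add_of_lt hlt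
        rw [show i + d + 1 = i + (d + 1) by ring, pow_add P i (d + 1), mul_assoc] at h
        have h2 := mul_left_cancel₀ (pow_ne_zero i hP.ne_zero) h
        have h3 : P ∣ P' ^ (k - i) := by
          rw [h2, pow_succ' P d, mul_assoc]; exact Dvd.intro _ rfl
        exact hnd (hP.dvd_of_dvd_pow h3)
      rcases lt_trichotomy (i : ℕ) j with h | h | h
      · exact absurd hij (main _ _ h)
      · exact Fin.ext h
      · exact absurd hij.symm (main _ _ h)
    · rintro ⟨I, hI⟩
      have h1 := dvd_of_norm_pow hI
      rw [← hPP, mul_pow] at h1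
      obtain ⟨A, B, hA, hB, rfl⟩ := exists_dvd_and_dvd_of_dvd_mul h1
      obtain ⟨i, hi, hass⟩ := (dvd_prime_pow hP _).mp hA
      obtain ⟨j, hj, hass'⟩ := (dvd_prime_pow hP' _).mp hB
      have h2 := associated_iff_eq.mp hass
      have h3 := associated_iff_eq.mp hass'
      subst h2 h3
      rw [map_mul, map_pow, map_pow, hN, hN', ← pow_add] at hI
      have := Nat.pow_right_injective hq.two_le hI
      refine ⟨⟨i, by omega⟩, ?_⟩
      have e : k - i = j := by omega
      simp [e]
  rw [← Nat.card_congr (Equiv.ofBijective _ this)]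
  simp
end

end partC

section partD
open Ideal


lemma legendre_flip {p q : ℕ} [Fact p.Prime] [Fact q.Prime] (hp4 : p % 4 = 3) (hq2 : q ≠ 2) :
    legendreSym q (-(p : ℤ)) = legendreSym p q := by
  have hp2 : p ≠ 2 := by rintro rfl; omega
  rw [show (-(p : ℤ)) = -1 * p by ring, legendreSym.mul, legendreSym.at_neg_one hq2]
  have hodd := (Nat.Prime.odd_of_ne_two (Fact.out : q.Prime) hq2)
  have : q % 4 = 1 ∨ q % 4 = 3 := by rcases hodd with ⟨k, hk⟩; omega
  rcases this with h | h
  · rw [ZMod.χ₄_nat_one_mod_four h, legendreSym.quadratic_reciprocity_one_mod_four h hp2, one_mul]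
  · rw [ZMod.χ₄_nat_three_mod_four h, legendreSym.quadratic_reciprocity_three_mod_four hp4 h]
    ring

lemma legendre_root {p q : ℕ} [Fact p.Prime] [Fact q.Prime] (hp4 : p % 4 = 3) {c : ℤ}
    (hc : 4 * c = p + 1) (hpq : q ≠ p) :
    legendreSym p q = 1 ↔ ∃ r : ℤ, (q : ℤ) ∣ r ^ 2 - r + c := by
  have hp2 : p ≠ 2 := by rintro rfl; omega
  have hq : q.Prime := Fact.out
  by_cases hq2 : q = 2
  · subst hq2
    have h2 : legendreSym p (2 : ℕ) = ZMod.χ₈ p := by exact_mod_cast legendreSym.at_two hp2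
    rw [h2, ZMod.χ₈_nat_eq_if_mod_eight]
    have hev : ∀ r : ℤ, ((2 : ℕ) : ℤ) ∣ r ^ 2 - r + c ↔ (2 : ℤ) ∣ c := by
      intro r
      have : (2 : ℤ) ∣ r ^ 2 - r := by
        have := Int.even_mul_pred_self r
        rw [show r ^ 2 - r = r * (r - 1) by ring]
        exact this.two_dvd
      push_cast
      exact (dvd_add_right this)
    simp only [hev, exists_const]
    have : p % 8 = 3 ∨ p % 8 = 7 := by omega
    rcases this with h | h
    · have h' : ¬ (2 : ℤ) ∣ c := by omega
      simp [h, h']; omega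
    · have h' : (2 : ℤ) ∣ c := by omega
      simp [h, h']; omega
  · have hodd : q % 2 = 1 := by
      rcases (Nat.Prime.odd_of_ne_two hq hq2) with ⟨k, hk⟩; omega
    have hq0 : ((-(p : ℤ) : ℤ) : ZMod q) ≠ 0 := by
      push_cast
      rw [neg_ne_zero, Ne, ZMod.natCast_eq_zero_iff]
      intro h
      exact hpq ((Nat.prime_dvd_prime_iff_eq hq Fact.out).mp h)
    rw [← legendre_flip hp4 hq2, legendreSym.eq_one_iff q hq0]
    have hqZ : Prime (q : ℤ) := Nat.prime_iff_prime_int.mp hq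
    have hq4 : ¬ (q : ℤ) ∣ 4 := by
      intro h
      have : (q : ℤ) ∣ 2 ^ 2 := by simpa using h
      have := hqZ.dvd_of_dvd_pow this
      have h3 : q ∣ 2 := by exact_mod_cast this
      exact hq2 ((Nat.prime_dvd_prime_iff_eq hq Nat.prime_two).mp h3)
    constructor
    · rintro ⟨x, hx⟩
      obtain ⟨s, hs, hs1⟩ : ∃ s : ℤ, (s : ZMod q) = x ∧ s % 2 = 1 := by
        obtain ⟨t, rfl⟩ := ZMod.intCast_surjective x
        rcases Int.emod_two_eq_zero_or_one t with h | h
        · exact ⟨t + q, by simp, by omega⟩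
        · exact ⟨t, rfl, h⟩
      obtain ⟨r, hr⟩ : ∃ r : ℤ, s = 2 * r - 1 := ⟨(s + 1) / 2, by omega⟩
      refine ⟨r, ?_⟩
      have h1 : (q : ℤ) ∣ s * s + p := by
        rw [← ZMod.intCast_zmod_eq_zero_iff_dvd]
        push_cast at hx ⊢
        rw [hs, ← hx]; ring
      have h2 : (q : ℤ) ∣ 4 * (r ^ 2 - r + c) := by
        have : 4 * (r ^ 2 - r + c) = s * s + p := by rw [hr]; linear_combination hc
        rwa [this]
      exact (hqZ.dvd_or_dvd h2).resolve_left hq4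
    · rintro ⟨r, hr⟩
      refine ⟨((2 * r - 1 : ℤ) : ZMod q), ?_⟩
      have h1 : (q : ℤ) ∣ -(p : ℤ) - (2 * r - 1) * (2 * r - 1) := by
        have : -(p : ℤ) - (2 * r - 1) * (2 * r - 1) = (r ^ 2 - r + c) * (-4) := by
          linear_combination hc
        rw [this]; exact hr.mul_right _
      rw [← Int.cast_mul, ← sub_eq_zero, ← Int.cast_sub, ZMod.intCast_zmod_eq_zero_iff_dvd]
      exact h1

section
variable {p : ℕ} {K : Type*} [Field K] [NumberField K] {θ : 𝓞 K} {c : ℤ}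

lemma QGen.dvd (h : QGen p K θ c) {q : ℕ} {a b : ℤ} (hd : (q : 𝓞 K) ∣ a + b * θ) :
    (q : ℤ) ∣ a ∧ (q : ℤ) ∣ b := by
  obtain ⟨y, hy⟩ := hd
  obtain ⟨u, v, rfl⟩ := h.rep y
  have := h.ext (a := a) (b := b) (a' := q * u) (b' := q * v) (by rw [hy]; push_cast; ring)
  exact ⟨⟨u, this.1⟩, ⟨v, this.2⟩⟩

lemma QGen.inert (h : QGen p K θ c) {q : ℕ} (hq : q.Prime)
    (hr : ¬ ∃ r : ℤ, (q : ℤ) ∣ r ^ 2 - r + c) : Prime (span {(q : 𝓞 K)}) := by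
  have hq0 : (q : 𝓞 K) ≠ 0 := by exact_mod_cast hq.ne_zero
  have hqZ : Prime (q : ℤ) := Nat.prime_iff_prime_int.mp hq
  have key : ∀ a b : ℤ, (q : ℤ) ∣ a ^ 2 + a * b + c * b ^ 2 → (q : 𝓞 K) ∣ a + b * θ := by
    intro a b hab
    by_cases hb : (q : ℤ) ∣ b
    · have ha : (q : ℤ) ∣ a := by
        obtain ⟨b', rfl⟩ := hb
        have : (q : ℤ) ∣ a ^ 2 := by
          have e : a ^ 2 = (a ^ 2 + a * (q * b') + c * (q * b') ^ 2) - q * (a * b' + c * q * b' ^ 2) := by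
            ring
          rw [e]; exact dvd_sub hab (Dvd.intro _ rfl)
        exact hqZ.dvd_of_dvd_pow this
      obtain ⟨b', rfl⟩ := hb
      obtain ⟨a', rfl⟩ := ha
      exact ⟨a' + b' * θ, by push_cast; ring⟩
    · exfalso
      have hcop : IsCoprime (q : ℤ) b := (hqZ.coprime_iff_not_dvd).mpr hb
      obtain ⟨u, v, huv⟩ := hcop
      -- v b = 1 - u q ; r = - a v
      apply hr
      refine ⟨- a * v, ?_⟩
      have e : (- a * v) ^ 2 - (- a * v) + c = v ^ 2 * (a ^ 2 + a * b + c * b ^ 2) +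
          q * (u * (a * v) + c * u * (1 + v * b)) := by
        have hv : v * b = 1 - u * q := by linarith
        linear_combination (-a * v - c * (1 + v * b)) * hv
      rw [e]
      exact dvd_add (hab.mul_left _) (Dvd.intro _ rfl)
  rw [Ideal.prime_iff_isPrime (by simpa using hq0), Ideal.span_singleton_prime hq0]
  refine ⟨hq0, ?_, ?_⟩
  · intro hu
    have := h.dvd (q := q) (a := 1) (b := 0) (by simpa using hu.dvd)
    exact hqZ.not_dvd_one this.1
  · intro x y hxy
    obtain ⟨a, b, rfl⟩ := h.rep x
    obtain ⟨a', b', rfl⟩ := h.rep y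
    obtain ⟨A, B, e⟩ := h.rep ((a + b * θ) * (a' + b' * θ))
    have hN := h.mul e
    rw [e] at hxy
    obtain ⟨⟨A', rfl⟩, ⟨B', rfl⟩⟩ := h.dvd hxy
    have : (q : ℤ) ∣ (a ^ 2 + a * b + c * b ^ 2) * (a' ^ 2 + a' * b' + c * b' ^ 2) := by
      rw [hN]
      exact ⟨q * A' ^ 2 + q * A' * B' + c * q * B' ^ 2, by ring⟩
    rcases hqZ.dvd_or_dvd this with h1 | h1
    · left; exact key _ _ h1
    · right; exact key _ _ h1

lemma QGen.ram (h : QGen p K θ c) (hp : p.Prime) (hquad : Module.finrank ℚ K = 2) :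
    ∃ P : Ideal (𝓞 K), Prime P ∧ absNorm P = p ∧ P * P = span {(p : 𝓞 K)} := by
  have hsq : (2 * θ - 1) * (2 * θ - 1) = -(p : 𝓞 K) := by
    have hc : (4 : 𝓞 K) * c = p + 1 := by exact_mod_cast congrArg (Int.cast : ℤ → 𝓞 K) h.hc
    linear_combination 4 * h.sq - hc
  have h1 : span {2 * θ - 1} * span {2 * θ - 1} = span {(p : 𝓞 K)} := by
    rw [Ideal.span_singleton_mul_span_singleton, hsq, Ideal.span_singleton_neg]
  have h2 : absNorm (span {2 * θ - 1}) = p := by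
    have := congrArg absNorm h1
    rw [map_mul, absNorm_span_nat hquad, ← pow_two] at this
    exact Nat.pow_left_injective (n := 2) (by norm_num) this
  refine ⟨_, ?_, h2, h1⟩
  have hne : span {2 * θ - 1} ≠ (⊥ : Ideal (𝓞 K)) := by
    intro hb; rw [hb, Ideal.absNorm_bot] at h2; exact hp.ne_zero h2.symm
  rw [Ideal.prime_iff_isPrime hne]
  exact Ideal.isPrime_of_irreducible_absNorm (by rw [h2]; exact hp)

lemma QGen.split (h : QGen p K θ c) (hp : p.Prime) (hquad : Module.finrank ℚ K = 2) {q : ℕ}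
    (hq : q.Prime) (hqp : q ≠ p) {r : ℤ} (hr : (q : ℤ) ∣ r ^ 2 - r + c) :
    ∃ P P' : Ideal (𝓞 K), Prime P ∧ Prime P' ∧ P ≠ P' ∧ absNorm P = q ∧ absNorm P' = q ∧ 
      P * P' = span {(q : 𝓞 K)} := by
  have hqZ : Prime (q : ℤ) := Nat.prime_iff_prime_int.mp hq
  obtain ⟨m, hm⟩ := hr
  have hmR : (r : 𝓞 K) ^ 2 - r + c = q * m := by exact_mod_cast congrArg (Int.cast : ℤ → 𝓞 K) hm
  have hcR : (4 : 𝓞 K) * c = p + 1 := by exact_mod_cast congrArg (Int.cast : ℤ → 𝓞 K) h.hc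
  obtain ⟨u, v, huv⟩ : IsCoprime (q : ℤ) p := by
    rw [Nat.isCoprime_iff_coprime]; exact (Nat.coprime_primes hq hp).mpr hqp
  have huvR : (u : 𝓞 K) * q + v * p = 1 := by exact_mod_cast congrArg (Int.cast : ℤ → 𝓞 K) huv
  -- the unit lies in any ideal containing both elements
  have hone : ∀ J : Ideal (𝓞 K), (q : 𝓞 K) * q ∈ J → (q : 𝓞 K) * (1 - 2 * r) ∈ J → (q : 𝓞 K) ∈ J := by
    intro J h1 h2
    have e : (q : 𝓞 K) = (u + v * 4 * m) * (q * q) + (- v * (1 - 2 * r)) * (q * (1 - 2 * r)) := by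
      linear_combination - (q : 𝓞 K) * huvR - v * q * hcR + 4 * v * q * hmR
    rw [e]
    exact J.add_mem (J.mul_mem_left _ h1) (J.mul_mem_left _ h2)
  have hone' : ∀ J : Ideal (𝓞 K), (q : 𝓞 K) ∈ J → (1 - 2 * r : 𝓞 K) ∈ J → (1 : 𝓞 K) ∈ J := by
    intro J h1 h2
    have e : (1 : 𝓞 K) = (u + v * 4 * m) * q + (- v * (1 - 2 * r)) * (1 - 2 * r) := by
      linear_combination - huvR - v * hcR + 4 * v * hmR
    rw [e]
    exact J.add_mem (J.mul_mem_left _ h1) (J.mul_mem_left _ h2)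
  let P : Ideal (𝓞 K) := span {(q : 𝓞 K), θ - r}
  let P' : Ideal (𝓞 K) := span {(q : 𝓞 K), θ - (1 - r)}
  have hqP : (q : 𝓞 K) ∈ P := Ideal.subset_span (by simp)
  have hqP' : (q : 𝓞 K) ∈ P' := Ideal.subset_span (by simp)
  have htP : θ - r ∈ P := Ideal.subset_span (by simp)
  have htP' : θ - (1 - r) ∈ P' := Ideal.subset_span (by simp)
  have hprod : P * P' = span {(q : 𝓞 K)} := by
    apply le_antisymm
    · rw [Ideal.span_pair_mul_span_pair, Ideal.span_le]
      intro x hx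
      simp only [Set.mem_insert_iff, Set.mem_singleton_iff] at hx
      rw [SetLike.mem_coe, Ideal.mem_span_singleton]
      rcases hx with rfl | rfl | rfl | rfl
      · exact Dvd.intro _ rfl
      · exact Dvd.intro _ rfl
      · exact Dvd.intro_left _ rfl
      · exact ⟨- m, by linear_combination h.sq - hmR⟩
    · rw [Ideal.span_singleton_le_iff_mem]
      apply hone
      · exact Ideal.mul_mem_mul hqP hqP'
      · have e : (q : 𝓞 K) * (1 - 2 * r) = (θ - r) * q - q * (θ - (1 - r)) := by ring
        rw [e]
        exact (P * P').sub_mem (Ideal.mul_mem_mul htP hqP') (Ideal.mul_mem_mul hqP htP')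
  have hnm : ∀ s : ℤ, θ - s ∉ span {(q : 𝓞 K)} := by
    intro s hs
    rw [Ideal.mem_span_singleton] at hs
    have := h.dvd (q := q) (a := -s) (b := 1) (by convert hs using 1; push_cast; ring)
    exact hqZ.not_dvd_one this.2
  have hP1 : P ≠ ⊤ := by
    intro hP
    rw [hP, Ideal.top_mul] at hprod
    exact hnm (1 - r) (by rw [← hprod]; push_cast; exact htP')
  have hP1' : P' ≠ ⊤ := by
    intro hP
    rw [hP, Ideal.mul_top] at hprod
    exact hnm r (by rw [← hprod]; exact htP)
  have hN := congrArg absNorm hprod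
  rw [map_mul, absNorm_span_nat hquad] at hN
  have n1 : absNorm P ≠ 1 := by rwa [Ne, Ideal.absNorm_eq_one_iff]
  have n2 : absNorm P' ≠ 1 := by rwa [Ne, Ideal.absNorm_eq_one_iff]
  have hPN : absNorm P = q ∧ absNorm P' = q := (Nat.Prime.mul_eq_prime_sq_iff hq n1 n2).mp hN
  have hprime : ∀ J : Ideal (𝓞 K), absNorm J = q → Prime J := by
    intro J hJ
    have hne : J ≠ ⊥ := by
      intro hb; rw [hb, Ideal.absNorm_bot] at hJ; exact hq.ne_zero hJ.symm
    rw [Ideal.prime_iff_isPrime hne]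
    exact Ideal.isPrime_of_irreducible_absNorm (by rw [hJ]; exact hq)
  refine ⟨P, P', hprime _ hPN.1, hprime _ hPN.2, ?_, hPN.1, hPN.2, hprod⟩
  intro hPP
  apply hP1
  rw [Ideal.eq_top_iff_one]
  apply hone' _ hqP
  have e : (1 - 2 * r : 𝓞 K) = (θ - r) - (θ - (1 - r)) := by ring
  rw [e]
  exact P.sub_mem htP (hPP ▸ htP')

lemma QGen.card_pow [Fact p.Prime] (h : QGen p K θ c) (hp4 : p % 4 = 3)
    (hquad : Module.finrank ℚ K = 2)
    {q : ℕ} (hq : q.Prime) (k : ℕ) :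
    (Nat.card {I : Ideal (𝓞 K) // absNorm I = q ^ k} : ℤ) =
      ∑ i ∈ Finset.range (k + 1), (legendreSym p q) ^ i := by
  have hp : p.Prime := Fact.out
  have : Fact q.Prime := ⟨hq⟩
  by_cases hqp : q = p
  · subst hqp
    obtain ⟨P, h1, h2, h3⟩ := h.ram hp hquad
    rw [card_ram hp h1 h2 h3]
    have : legendreSym q q = 0 := by simp [legendreSym.eq_zero_iff]
    rw [this, Finset.sum_range_succ']
    simp
  · have hroot := legendre_root hp4 h.hc hqp
    by_cases hl : legendreSym p q = 1
    · obtain ⟨r, hr⟩ := hroot.mp hl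
      obtain ⟨P, P', h1, h2, h3, h4, h5, h6⟩ := h.split hp hquad hq hqp hr
      rw [card_split hq h1 h2 h3 h4 h5 h6, hl]
      simp
    · rw [card_inert hq hquad (h.inert hq (fun hh => hl (hroot.mpr hh)))]
      have h0 : ((q : ℤ) : ZMod p) ≠ 0 := by
        rw [Int.cast_natCast, Ne, ZMod.natCast_eq_zero_iff]
        intro hd
        exact hqp ((Nat.prime_dvd_prime_iff_eq hp hq).mp hd).symm
      have hm1 : legendreSym p q = -1 := (legendreSym.eq_one_or_neg_one p h0).resolve_left hl
      rw [hm1]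
      have := neg_one_geom_sum (R := ℤ) (n := k + 1)
      rw [this]
      simp only [Nat.even_add_one]
      split_ifs <;> simp_all
end

end partD

section partE


section secE
open Ideal ArithmeticFunction

noncomputable def chiP (p : ℕ) [Fact p.Prime] : DirichletCharacter ℂ p :=
  (quadraticChar (ZMod p)).ringHomComp (Int.castRingHom ℂ)

lemma chiP_int (p : ℕ) [Fact p.Prime] (a : ℤ) : chiP p (a : ZMod p) = (legendreSym p a : ℂ) := by
  simp [chiP, legendreSym, MulChar.ringHomComp_apply]

lemma chiP_nat (p : ℕ) [Fact p.Prime] (a : ℕ) :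
    chiP p (a : ZMod p) = (legendreSym p (a : ℤ) : ℂ) := by
  rw [← chiP_int]; simp

noncomputable def idealCount (K : Type*) [Field K] [NumberField K] : ArithmeticFunction ℂ :=
  toArithmeticFunction (fun n ↦ (Nat.card {I : Ideal (𝓞 K) // absNorm I = n} : ℂ))

variable {p : ℕ} [Fact p.Prime] {K : Type*} [Field K] [NumberField K]

lemma idealCount_apply {n : ℕ} (hn : n ≠ 0) :
    idealCount K n = (Nat.card {I : Ideal (𝓞 K) // absNorm I = n} : ℂ) := by
  simp [idealCount, toArithmeticFunction, hn]

lemma idealCount_mult (hquad : Module.finrank ℚ K = 2) : (idealCount K).IsMultiplicative := by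
  refine IsMultiplicative.iff_ne_zero.mpr ⟨?_, fun {m n} hm hn hmn ↦ ?_⟩
  · rw [idealCount_apply one_ne_zero]
    simp [Ideal.absNorm_eq_one_iff]
  · rw [idealCount_apply (mul_ne_zero hm hn), idealCount_apply hm, idealCount_apply hn,
      card_ideal_mul hquad hm hn hmn]
    push_cast; rfl

lemma idealCount_eq (hp4 : p % 4 = 3) (α : K) (hα : α ^ 2 = -(p : K))
    (hquad : Module.finrank ℚ K = 2) :
    idealCount K = toArithmeticFunction (chiP p ·) * ((ArithmeticFunction.zeta : ArithmeticFunction ℕ) : ArithmeticFunction ℂ) := by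
  obtain ⟨θ, c, h⟩ := exists_QGen p hp4 K α hα hquad
  have hχ := (chiP p).isMultiplicative_toArithmeticFunction
  refine (IsMultiplicative.eq_iff_eq_on_prime_powers _ (idealCount_mult hquad) _
    (hχ.mul isMultiplicative_zeta.natCast)).mpr fun q k hq ↦ ?_
  rw [idealCount_apply (pow_ne_zero _ hq.ne_zero), coe_mul_zeta_apply, Nat.sum_divisors_prime_pow hq]
  have := h.card_pow hp4 hquad hq k
  have h2 := congrArg (Int.cast : ℤ → ℂ) this
  rw [Int.cast_natCast] at h2
  rw [h2, Int.cast_sum]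
  refine Finset.sum_congr rfl fun i _ ↦ ?_
  rw [← DirichletCharacter.apply_eq_toArithmeticFunction_apply _ (pow_ne_zero _ hq.ne_zero)]
  rw [Nat.cast_pow, map_pow, chiP_nat, Int.cast_pow]

lemma dedekindZeta_eq (hp4 : p % 4 = 3) (α : K) (hα : α ^ 2 = -(p : K))
    (hquad : Module.finrank ℚ K = 2) {s : ℂ} (hs : 1 < s.re) :
    dedekindZeta K s = ZMod.LFunction (chiP p) s * riemannZeta s := by
  have h1 : dedekindZeta K s = LSeries (idealCount K ·) s :=
    LSeries_congr (fun {n} hn ↦ (idealCount_apply hn).symm) s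
  have h3 : ∀ {n : ℕ}, n ≠ 0 → (chiP p ·) n = toArithmeticFunction (chiP p ·) n := fun hn ↦
    DirichletCharacter.apply_eq_toArithmeticFunction_apply _ hn
  rw [h1, idealCount_eq hp4 α hα hquad, LSeries_mul']
  · rw [ZMod.LFunction_eq_LSeries _ hs, ← LSeries_zeta_eq_riemannZeta hs]
    congr 1
    · exact (LSeries_congr h3 s).symm
  · exact (LSeriesSummable_congr s h3).mp ((chiP p).LSeriesSummable_of_one_lt_re hs)
  · exact LSeriesSummable_zeta_iff.mpr hs

lemma chiP_odd (hp4 : p % 4 = 3) : (chiP p : ZMod p → ℂ).Odd := by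
  intro x
  have hp2 : p ≠ 2 := by rintro rfl; omega
  have : chiP p (-1) = -1 := by
    have := chiP_int p (-1)
    rw [legendreSym.at_neg_one hp2, ZMod.χ₄_nat_three_mod_four hp4] at this
    simpa using this
  rw [← neg_one_mul, map_mul, this, neg_one_mul]

open Filter Topology in
lemma residue_eq_L (hp4 : p % 4 = 3) (α : K) (hα : α ^ 2 = -(p : K))
    (hquad : Module.finrank ℚ K = 2) :
    (dedekindZeta_residue K : ℂ) =
      (p : ℂ)⁻¹ * ∑ j : ZMod p, chiP p j * HurwitzZeta.hurwitzZetaOdd (ZMod.toAddCircle j) 1 := by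
  have hd := ZMod.LFunction_def_odd (chiP_odd (p := p) hp4)
  have hcont : Continuous (ZMod.LFunction (chiP p)) := by
    rw [funext hd]
    refine Continuous.mul ?_ ?_
    · refine Continuous.const_cpow continuous_neg (Or.inl ?_)
      exact_mod_cast (Fact.out : p.Prime).ne_zero
    · refine continuous_finsetSum _ fun j _ ↦ continuous_const.mul
        (HurwitzZeta.differentiable_hurwitzZetaOdd _).continuous
  have hz : Tendsto (fun s : ℝ ↦ ((s : ℂ) - 1) * riemannZeta s) (𝓝[>] 1) (𝓝 1) := by
    refine riemannZeta_residue_one.comp ?_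
    refine tendsto_nhdsWithin_iff.mpr ⟨?_, ?_⟩
    · have : Tendsto (fun s : ℝ ↦ (s : ℂ)) (𝓝 1) (𝓝 ((1 : ℝ) : ℂ)) :=
        Complex.continuous_ofReal.tendsto 1
      simpa using this.mono_left nhdsWithin_le_nhds
    · filter_upwards [self_mem_nhdsWithin] with s hs
      have : s ≠ 1 := ne_of_gt hs
      simpa using this
  have hL : Tendsto (fun s : ℝ ↦ ZMod.LFunction (chiP p) s) (𝓝[>] 1)
      (𝓝 (ZMod.LFunction (chiP p) 1)) := by
    have : Tendsto (fun s : ℝ ↦ ZMod.LFunction (chiP p) (s : ℂ)) (𝓝 1)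
        (𝓝 (ZMod.LFunction (chiP p) ((1 : ℝ) : ℂ))) :=
      (hcont.comp Complex.continuous_ofReal).tendsto 1
    simpa using this.mono_left nhdsWithin_le_nhds
  have h1 := tendsto_sub_one_mul_dedekindZeta_nhdsGT K
  have h2 := hL.mul hz
  have := tendsto_nhds_unique h1 (h2.congr' ?_)
  · rw [this, mul_one, hd, Complex.cpow_neg_one]
  · filter_upwards [self_mem_nhdsWithin] with s hs
    rw [dedekindZeta_eq hp4 α hα hquad (by simpa using hs)]
    ring
end secE

end partE

section partF


section secF
open Filter Topology

lemma rpow_diff_bound {x y : ℝ} {n : ℕ} (hn : n ≠ 0) (hx : x ∈ Set.Icc (n : ℝ) (n + 1))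
    (hy : y ∈ Set.Icc (n : ℝ) (n + 1)) {s : ℝ} (hs1 : 1 ≤ s) (hs2 : s ≤ 2) :
    |1 / x ^ s - 1 / y ^ s| ≤ 2 / (n : ℝ) ^ 2 := by
  have hn1 : (1 : ℝ) ≤ n := by exact_mod_cast Nat.one_le_iff_ne_zero.mpr hn
  have hn0 : (0 : ℝ) < n := by linarith
  have up : ∀ z ∈ Set.Icc (n : ℝ) (n + 1), 1 / z ^ s ≤ 1 / (n : ℝ) ^ s := fun z hz ↦
    one_div_le_one_div_of_le (rpow_pos_of_pos hn0 _)
      (rpow_le_rpow hn0.le hz.1 (by linarith))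
  have lo : ∀ z ∈ Set.Icc (n : ℝ) (n + 1), 1 / (n + 1 : ℝ) ^ s ≤ 1 / z ^ s := fun z hz ↦
    one_div_le_one_div_of_le (rpow_pos_of_pos (by linarith [hz.1]) _)
      (rpow_le_rpow (by linarith [hz.1]) hz.2 (by linarith))
  have main : 1 / (n : ℝ) ^ s - 1 / (n + 1 : ℝ) ^ s ≤ 2 / (n : ℝ) ^ 2 := by
    have e : 1 / (n + 1 : ℝ) ^ s = 1 / (n : ℝ) ^ s * ((n : ℝ) / (n + 1)) ^ s := by
      rw [div_rpow hn0.le (by linarith)]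
      have := (rpow_pos_of_pos hn0 s).ne'
      field_simp
    have h1 : ((n : ℝ) / (n + 1)) ^ (2 : ℝ) ≤ ((n : ℝ) / (n + 1)) ^ s :=
      rpow_le_rpow_of_exponent_ge (by positivity) (by rw [div_le_one (by positivity)]; linarith) hs2
    have h2 : 1 / (n : ℝ) ^ s ≤ 1 / n :=
      one_div_le_one_div_of_le hn0 (by
        calc (n : ℝ) = (n : ℝ) ^ (1 : ℝ) := (rpow_one _).symm
          _ ≤ _ := rpow_le_rpow_of_exponent_le hn1 hs1)
    have h3 : 1 - ((n : ℝ) / (n + 1)) ^ (2 : ℝ) ≤ 2 / n := by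
      rw [rpow_two, div_pow, sub_le_iff_le_add, div_add_div _ _ hn0.ne' (by positivity), le_div_iff₀ (by positivity)]
      nlinarith
    have h4 : ((n : ℝ) / (n + 1)) ^ s ≤ 1 :=
      rpow_le_one (by positivity) (by rw [div_le_one (by positivity)]; linarith) (by linarith)
    calc _ = 1 / (n : ℝ) ^ s * (1 - ((n : ℝ) / (n + 1)) ^ s) := by rw [e]; ring
      _ ≤ 1 / n * (2 / n) := mul_le_mul h2 (by linarith) (by linarith) (by positivity)
      _ = _ := by field_simp
  rw [abs_le]
  constructor <;> linarith [up x hx, up y hy, lo x hx, lo y hy]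

lemma hasSum_cot {a : ℝ} (ha : a ∈ Set.Ioo (0 : ℝ) 1) 
    (hsm : Summable (fun n : ℕ ↦ (1 / (n + a : ℂ) - 1 / (n + 1 - a : ℂ)) / 2)) :
    ∑' n : ℕ, (1 / (n + a : ℂ) - 1 / (n + 1 - a : ℂ)) / 2 =
      (π / 2 * Real.cot (π * a) : ℝ) := by
  have haZ : (a : ℂ) ∈ Complex.integerComplement := by
    rintro ⟨m, hm⟩
    have : (m : ℝ) = a := by exact_mod_cast hm
    have h0 : (0 : ℝ) < m := this ▸ ha.1
    have h1 : (m : ℝ) < 1 := this ▸ ha.2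
    have h0' : 0 < m := by exact_mod_cast h0
    have h1' : m < 1 := by exact_mod_cast h1
    omega
  have hlim : Tendsto (fun n : ℕ ↦ 1 / ((n : ℂ) + a)) atTop (𝓝 0) := by
    simp only [one_div]
    refine tendsto_inv₀_cobounded.comp ?_
    exact (tendsto_add_const_cobounded (a : ℂ)).comp tendsto_natCast_atTop_cobounded
  have hps : ∀ N : ℕ, ∑ n ∈ range N, (1 / (n + a : ℂ) - 1 / (n + 1 - a : ℂ)) / 2 =
      ((1 / (a : ℂ) - 1 / (N + a : ℂ)) + ∑ n ∈ range N, cotTerm a n) / 2 := by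
    intro N
    induction N with
    | zero => simp
    | succ N ih =>
      rw [sum_range_succ, sum_range_succ, ih]
      have e : (1 : ℂ) / (N + 1 - a) = - (1 / ((a : ℂ) - (N + 1))) := by
        rw [← one_div_neg_eq_neg_one_div, neg_sub]
      have e2 : ((N + 1 : ℕ) : ℂ) + a = a + (N + 1) := by push_cast; ring
      rw [e, e2]
      simp only [cotTerm]
      ring
  have h1 := hsm.hasSum.tendsto_sum_nat
  have h2 := (((tendsto_const_nhds (x := 1 / (a : ℂ))).sub hlim).add
    (tendsto_logDeriv_euler_cot_sub haZ)).div_const 2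
  rw [tendsto_nhds_unique h1 (h2.congr fun N ↦ (hps N).symm)]
  push_cast
  ring

lemma hurwitzOdd_one {a : ℝ} (ha : a ∈ Set.Ioo (0 : ℝ) 1) :
    HurwitzZeta.hurwitzZetaOdd a 1 = (π / 2 * Real.cot (π * a) : ℝ) := by
  have ha' : a ∈ Set.Icc (0 : ℝ) 1 := ⟨ha.1.le, ha.2.le⟩
  have h1a : 0 < 1 - a := by linarith [ha.2]
  set F : ℝ → ℕ → ℂ := fun s n ↦ (1 / (n + a : ℂ) ^ (s : ℂ) - 1 / (n + 1 - a : ℂ) ^ (s : ℂ)) / 2 with hF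
  have hFr : ∀ s n, F s n = ((1 / (n + a : ℝ) ^ s - 1 / (n + 1 - a : ℝ) ^ s) / 2 : ℝ) := by
    intro s n
    have hn : (0 : ℝ) ≤ n := n.cast_nonneg
    simp only [hF]
    push_cast
    rw [Complex.ofReal_cpow (by linarith [ha.1]), Complex.ofReal_cpow (by linarith)]
    push_cast; rfl
  set bound : ℕ → ℝ := fun n ↦ 2 / (n : ℝ) ^ 2 + if n = 0 then 1 / a ^ (2 : ℝ) + 1 / (1 - a) ^ (2 : ℝ) else 0 with hb
  have hbs : Summable bound := by
    refine Summable.add ?_ ?_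
    · simpa [div_eq_mul_inv] using (Real.summable_nat_pow_inv.mpr (by norm_num : 1 < 2)).mul_left (2 : ℝ)
    · exact summable_of_ne_finset_zero (s := {0}) (by intro n hn; simp at hn; simp [hn])
  have hFb : ∀ s : ℝ, 1 ≤ s → s ≤ 2 → ∀ n, ‖F s n‖ ≤ bound n := by
    intro s hs1 hs2 n
    rw [hFr, Complex.norm_real, Real.norm_eq_abs, abs_div, abs_two]
    rcases eq_or_ne n 0 with rfl | hn
    · have e : ∀ x : ℝ, 0 < x → x ≤ 1 → 0 ≤ 1 / x ^ s ∧ 1 / x ^ s ≤ 1 / x ^ (2 : ℝ) := by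
        intro x hx hx1
        refine ⟨by positivity, one_div_le_one_div_of_le (by positivity) ?_⟩
        exact rpow_le_rpow_of_exponent_ge hx hx1 hs2
      have h1 := e a ha.1 ha.2.le
      have h2 := e (1 - a) h1a (by linarith [ha.1])
      simp only [hb, Nat.cast_zero, zero_add, if_true]
      have : |1 / a ^ s - 1 / (1 - a) ^ s| ≤ 1 / a ^ (2 : ℝ) + 1 / (1 - a) ^ (2 : ℝ) := by
        rw [abs_le]; constructor <;> linarith
      have h5 := abs_nonneg (1 / a ^ s - 1 / (1 - a) ^ s)
      have h6 : (2 : ℝ) / 0 ^ 2 = 0 := by norm_num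
      have h7 : (1 : ℝ) - a = 0 + 1 - a := by ring
      rw [h6, zero_add]
      linarith
    · have := rpow_diff_bound hn (x := n + a) (y := n + 1 - a)
        ⟨by linarith [ha.1], by linarith [ha.2]⟩ ⟨by linarith [ha.2], by linarith [ha.1]⟩ hs1 hs2
      simp only [hb, hn, if_false, add_zero]
      have h5 := abs_nonneg (1 / (n + a) ^ s - 1 / (n + 1 - a) ^ s)
      linarith
  have hFc : ∀ n, Tendsto (fun s ↦ F s n) (𝓝[>] 1) (𝓝 (F 1 n)) := by
    intro n
    have hn : (0 : ℝ) ≤ n := n.cast_nonneg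
    have : Continuous fun s ↦ F s n := by
      simp only [hFr]
      refine Complex.continuous_ofReal.comp ?_
      refine Continuous.div_const (Continuous.sub ?_ ?_) _
      · exact continuous_const.div (Real.continuous_const_rpow (by linarith [ha.1]))
          fun s ↦ (rpow_pos_of_pos (by linarith [ha.1]) s).ne'
      · exact continuous_const.div (Real.continuous_const_rpow (by linarith [ha.2]))
          fun s ↦ (rpow_pos_of_pos (by linarith [ha.2]) s).ne'
    exact (this.tendsto 1).mono_left nhdsWithin_le_nhds
  have hT : Tendsto (fun s ↦ ∑' n, F s n) (𝓝[>] 1) (𝓝 (∑' n, F 1 n)) := by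
    refine tendsto_tsum_of_dominated_convergence hbs hFc ?_
    filter_upwards [Ioo_mem_nhdsGT (show (1 : ℝ) < 2 by norm_num)] with s hs n
    exact hFb s hs.1.le hs.2.le n
  have hH : Tendsto (fun s : ℝ ↦ HurwitzZeta.hurwitzZetaOdd a (s : ℂ)) (𝓝[>] 1)
      (𝓝 (HurwitzZeta.hurwitzZetaOdd a ((1 : ℝ) : ℂ))) :=
    (((HurwitzZeta.differentiable_hurwitzZetaOdd a).continuous.comp
      Complex.continuous_ofReal).tendsto 1).mono_left nhdsWithin_le_nhds
  have heq := tendsto_nhds_unique hH (hT.congr' (by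
    filter_upwards [self_mem_nhdsWithin] with s hs
    exact (HurwitzZeta.hasSum_nat_hurwitzZetaOdd_of_mem_Icc ha' (by simpa using hs)).tsum_eq))
  have hF1 : F 1 = fun n : ℕ ↦ (1 / (n + a : ℂ) - 1 / (n + 1 - a : ℂ)) / 2 := by
    funext n; simp [hF]
  rw [Complex.ofReal_one] at heq
  rw [heq, hF1]
  refine hasSum_cot ha ?_
  rw [← hF1]
  exact Summable.of_norm_bounded hbs (hFb 1 le_rfl one_le_two)
end secF

end partF

section secG

lemma sum_Ioo_zmod (p : ℕ) [NeZero p] (F : ZMod p → ℝ) (h0 : F 0 = 0) :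
    ∑ n ∈ Finset.Ioo 0 p, F (n : ZMod p) = ∑ j : ZMod p, F j := by
  rw [← Finset.sum_erase univ h0]
  refine Finset.sum_nbij' (fun n ↦ (n : ZMod p)) (fun j ↦ j.val) ?_ ?_ ?_ ?_ ?_
  · intro n hn
    simp only [Finset.mem_Ioo] at hn
    simp only [mem_erase, mem_univ, and_true, ne_eq, ZMod.natCast_eq_zero_iff]
    exact Nat.not_dvd_of_pos_of_lt hn.1 hn.2
  · intro j hj
    simp only [mem_erase, mem_univ, and_true, ne_eq] at hj
    simp only [Finset.mem_Ioo]
    exact ⟨Nat.pos_of_ne_zero ((ZMod.val_ne_zero j).mpr hj), ZMod.val_lt j⟩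
  · intro n hn
    simp only [Finset.mem_Ioo] at hn
    exact ZMod.val_cast_of_lt hn.2
  · intro j _
    exact ZMod.natCast_zmod_val j
  · intro n _; rfl

noncomputable def ctP (p : ℕ) (j : ZMod p) : ℝ := Real.cot (π * (j.val / p))

lemma real_cot_add_int_mul_pi (x : ℝ) (n : ℤ) : Real.cot (x + n * π) = Real.cot x := by
  rw [Real.cot_eq_cos_div_sin, Real.cot_eq_cos_div_sin, Real.cos_add_int_mul_pi,
    Real.sin_add_int_mul_pi]
  have : ((-1 : ℝ) ^ n) ≠ 0 := zpow_ne_zero _ (by norm_num)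
  rw [mul_div_mul_left _ _ this]

lemma ctP_int (p : ℕ) [NeZero p] (m : ℤ) : ctP p (m : ZMod p) = Real.cot (π * m / p) := by
  have hp : (p : ℝ) ≠ 0 := Nat.cast_ne_zero.mpr (NeZero.ne p)
  have h : (((m : ZMod p).val : ℤ)) = m % p := ZMod.val_intCast m
  have h2 : (((m : ZMod p).val : ℝ)) = ((m % p : ℤ) : ℝ) := by exact_mod_cast h
  have h3 : (m : ℝ) = ((m % p : ℤ) : ℝ) + p * ((m / p : ℤ) : ℝ) := by
    exact_mod_cast (Int.emod_add_mul_ediv m p).symm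
  have h4 : π * m / p = π * (((m % p : ℤ) : ℝ) / p) + ((m / p : ℤ) : ℝ) * π := by
    rw [h3]; field_simp
  rw [ctP, h2, h4, real_cot_add_int_mul_pi]

lemma ctP_zero (p : ℕ) : ctP p 0 = 0 := by
  simp [ctP, Real.cot_eq_cos_div_sin]

lemma ctP_neg (p : ℕ) [NeZero p] (j : ZMod p) : ctP p (-j) = - ctP p j := by
  obtain ⟨m, rfl⟩ := ZMod.intCast_surjective j
  rw [← Int.cast_neg, ctP_int, ctP_int]
  rw [Real.cot_eq_cos_div_sin, Real.cot_eq_cos_div_sin]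
  push_cast
  rw [show π * -(m : ℝ) / p = -(π * m / p) by ring, Real.cos_neg, Real.sin_neg, div_neg]

variable {p : ℕ} [Fact p.Prime]

lemma dedekindSum_eq (b : ℕ) :
    dedekindSum b p = 1 / (4 * (p : ℝ)) * ∑ j : ZMod p, ctP p j * ctP p (j * (b : ZMod p)) := by
  rw [dedekindSum, ← sum_Ioo_zmod p _ (by simp [ctP_zero])]
  congr 1
  refine Finset.sum_congr rfl fun n _ ↦ ?_
  have h1 := ctP_int p (n : ℤ)
  have h2 := ctP_int p ((n : ℤ) * b)
  push_cast at h1 h2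
  rw [h1, h2]
  push_cast
  rw [mul_assoc]

noncomputable def XP (p : ℕ) [Fact p.Prime] (j : ZMod p) : ℝ := (quadraticChar (ZMod p) j : ℝ)

lemma XP_neg (hp4 : p % 4 = 3) (j : ZMod p) : XP p (-j) = - XP p j := by
  have h := chiP_odd (p := p) hp4 j
  simp only [chiP, MulChar.ringHomComp_apply] at h
  simp only [XP]
  have h' : quadraticChar (ZMod p) (-j) = - quadraticChar (ZMod p) j := by
    have h2 : ((quadraticChar (ZMod p) (-j) : ℤ) : ℂ) = ((- quadraticChar (ZMod p) j : ℤ) : ℂ) := by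
      simpa using h
    exact_mod_cast h2
  rw [h']; push_cast; rfl

lemma XP_mul (i j : ZMod p) : XP p (i * j) = XP p i * XP p j := by
  simp only [XP, map_mul, Int.cast_mul]

lemma XP_sq {j : ZMod p} (hj : j ≠ 0) : XP p j * XP p j = 1 := by
  have := quadraticChar_sq_one hj
  simp only [XP]
  rw [← sq]
  exact_mod_cast this

lemma sum_residue (hp4 : p % 4 = 3) (g : ZMod p → ℝ) (hg : ∀ j, g (-j) = - g j) :
    ∑ j : ZMod p, (if XP p j = 1 then g j else 0) = 1 / 2 * ∑ j : ZMod p, XP p j * g j := by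
  have h1 : ∑ j : ZMod p, (if XP p j = 1 then g j else 0)
      = ∑ j : ZMod p, (if XP p j = -1 then - g j else 0) := by
    rw [← Equiv.sum_comp (Equiv.neg (ZMod p))]
    refine Finset.sum_congr rfl fun j _ ↦ ?_
    simp only [Equiv.neg_apply, hg, XP_neg hp4, neg_eq_iff_eq_neg]
  have h2 : ∑ j : ZMod p, XP p j * g j = ∑ j : ZMod p, (if XP p j = 1 then g j else 0)
      + ∑ j : ZMod p, (if XP p j = -1 then - g j else 0) := by
    rw [← Finset.sum_add_distrib]
    refine Finset.sum_congr rfl fun j _ ↦ ?_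
    rcases eq_or_ne j 0 with rfl | hj
    · simp [XP]
    · rcases mul_self_eq_one_iff.mp (XP_sq hj) with h | h <;> rw [h] <;> norm_num
  rw [h2, ← h1]; ring

lemma sum_dedekind (hp4 : p % 4 = 3) :
    ∑ b ∈ (Finset.Ioo 0 p).filter (fun b : ℕ => legendreSym p (b : ℤ) = 1), dedekindSum b p
      = (∑ j : ZMod p, XP p j * ctP p j) ^ 2 / (8 * p) := by
  set C := ∑ j : ZMod p, XP p j * ctP p j with hC
  set g : ZMod p → ℝ := fun b ↦ 1 / (4 * (p : ℝ)) * ∑ j : ZMod p, ctP p j * ctP p (j * b) with hg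
  have hgn : ∀ j, g (-j) = - g j := by
    intro j
    simp only [hg, mul_neg, ctP_neg, Finset.sum_neg_distrib]
  have hinner : ∀ j : ZMod p, ∑ b : ZMod p, XP p b * (ctP p j * ctP p (j * b))
      = C * (XP p j * ctP p j) := by
    intro j
    rcases eq_or_ne j 0 with rfl | hj
    · simp [ctP_zero]
    · have : C = ∑ b : ZMod p, XP p (j * b) * ctP p (j * b) :=
        (Equiv.sum_comp (Equiv.mulLeft₀ j hj) fun b ↦ XP p b * ctP p b).symm
      rw [this, Finset.sum_mul]
      refine Finset.sum_congr rfl fun b _ ↦ ?_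
      rw [XP_mul]
      linear_combination (-(XP p b * ctP p j * ctP p (j * b))) * XP_sq hj
  rw [Finset.sum_filter]
  calc _ = ∑ b ∈ Finset.Ioo 0 p, (if XP p (b : ZMod p) = 1 then g (b : ZMod p) else 0) := by
        refine Finset.sum_congr rfl fun b _ ↦ ?_
        have : legendreSym p (b : ℤ) = 1 ↔ XP p (b : ZMod p) = 1 := by
          simp only [legendreSym, XP, Int.cast_natCast]
          norm_cast
        simp only [this, dedekindSum_eq, hg]
    _ = ∑ j : ZMod p, (if XP p j = 1 then g j else 0) :=
        sum_Ioo_zmod p (fun j ↦ if XP p j = 1 then g j else 0) (by simp [XP])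
    _ = 1 / 2 * ∑ j : ZMod p, XP p j * g j := sum_residue hp4 g hgn
    _ = 1 / (8 * p) * ∑ b : ZMod p, ∑ j : ZMod p, XP p b * (ctP p j * ctP p (j * b)) := by
        simp only [hg, Finset.mul_sum]
        refine Finset.sum_congr rfl fun b _ ↦ Finset.sum_congr rfl fun j _ ↦ ?_
        ring
    _ = 1 / (8 * p) * (C * C) := by
        rw [Finset.sum_comm]
        simp only [hinner, ← Finset.mul_sum]
        rw [← hC]
    _ = _ := by ring

lemma classNumber_eq (hp3 : 3 < p) (hp4 : p % 4 = 3)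
    (K : Type*) [Field K] [NumberField K]
    (α : K) (hα : α ^ 2 = -(p : K)) (hquad : Module.finrank ℚ K = 2) :
    π * classNumber K / √p = (p : ℝ)⁻¹ * (π / 2 * ∑ j : ZMod p, XP p j * ctP p j) := by
  have h1 := residue_eq_L (p := p) hp4 α hα hquad
  rw [residue_eq p hp3 hp4 K α hα hquad] at h1
  have h2 : ∀ j : ZMod p, chiP p j * HurwitzZeta.hurwitzZetaOdd (ZMod.toAddCircle j) 1 =
      ((π / 2 * (XP p j * ctP p j) : ℝ) : ℂ) := by
    intro j
    have hx : chiP p j = ((XP p j : ℝ) : ℂ) := by simp [chiP, XP, MulChar.ringHomComp_apply]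
    rcases eq_or_ne j 0 with rfl | hj
    · rw [hx]; simp [XP]
    · have hp0 : (0 : ℝ) < p := by exact_mod_cast (Fact.out : p.Prime).pos
      rw [ZMod.toAddCircle_apply, hurwitzOdd_one (a := (j.val : ℝ) / p), hx]
      · simp only [ctP]; push_cast; ring
      · constructor
        · have : (0 : ℝ) < j.val := by
            exact_mod_cast Nat.pos_of_ne_zero ((ZMod.val_ne_zero j).mpr hj)
          positivity
        · rw [div_lt_one hp0]; exact_mod_cast ZMod.val_lt j
  simp only [h2] at h1
  rw [← Complex.ofReal_sum, ← Finset.mul_sum] at h1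
  rw [show ((p : ℂ))⁻¹ = (((p : ℝ)⁻¹ : ℝ) : ℂ) by push_cast; rfl, ← Complex.ofReal_mul] at h1
  exact Complex.ofReal_injective h1
end secG

theorem classNumber_sq_eq_two_sum_dedekindSum_residues
    (p : ℕ) [Fact p.Prime] (hp3 : 3 < p) (hp4 : p % 4 = 3)
    (K : Type*) [Field K] [NumberField K]
    (α : K) (hα : α ^ 2 = -(p : K)) (hquad : Module.finrank ℚ K = 2) :
    ((NumberField.classNumber K : ℝ)) ^ 2 =
      2 * ∑ b ∈ (Finset.Ioo 0 p).filter (fun b : ℕ => legendreSym p (b : ℤ) = 1),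
        dedekindSum b p := by
  have h := classNumber_eq hp3 hp4 K α hα hquad
  rw [sum_dedekind hp4]
  set C := ∑ j : ZMod p, XP p j * ctP p j
  have hp0 : (0 : ℝ) < p := by exact_mod_cast (Fact.out : p.Prime).pos
  have hs : √(p : ℝ) ^ 2 = p := Real.sq_sqrt hp0.le
  have hs0 : √(p : ℝ) ≠ 0 := (Real.sqrt_pos.mpr hp0).ne'
  have hpi := Real.pi_ne_zero
  have h3 : (classNumber K : ℝ) = √p * C / (2 * p) := by
    field_simp at h ⊢
    linarith
  rw [h3, div_pow, mul_pow, hs]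
  field_simp
  ring
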